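/- arXiv:1807.00164 — 3 statements merged into one kernel-verified Lean document; each statement's English description precedes it below -/
import Mathlib

section
/- In a Jordan algebra over a field of characteristic not 2, for all a, b: [T_{a^2}, T_{b^2}] = 4( T_b T_a T_b T_a - T_a T_b T_a T_b + T_a T_{a*b} T_b - T_b T_{a*b} T_a ). -/
/-- The linearized Jordan identity `[T_b, T_{a²}] + 2 [T_a, T_{ab}] = 0`, applied to `x`. -/
theorem jordan_linearized {F V : Type*} [Field F] (h2 : (2 : F) ≠ 0)
    [AddCommGroup V] [Module F V]
    (mul : V →ₗ[F] V →ₗ[F] V)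
    (comm : ∀ a b : V, mul a b = mul b a)
    (jordan : ∀ a b : V, mul a (mul b (mul a a)) = mul (mul a b) (mul a a)) (a b x : V) :
    mul b (mul (mul a a) x) + (2 : F) • mul a (mul (mul a b) x) =
      mul (mul a a) (mul b x) + (2 : F) • mul (mul a b) (mul a x) := by
  have hJ : ∀ a : V, mul a (mul (mul a a) x) = mul (mul a a) (mul a x) := fun a => by
    rw [comm (mul a a) x, jordan, comm (mul a a)]
  have hp := hJ (a + b)
  have hm := hJ (a - b)
  have hb := hJ b
  simp only [map_add, map_sub, LinearMap.add_apply, LinearMap.sub_apply, comm b a] at hp hm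
  apply smul_right_injective V h2
  linear_combination (norm := module) hp - hm - (2 : F) • hb

theorem stmt7 {F V : Type*} [Field F] (h2 : (2 : F) ≠ 0)
    [AddCommGroup V] [Module F V]
    (mul : V →ₗ[F] V →ₗ[F] V)
    (comm : ∀ a b : V, mul a b = mul b a)
    (jordan : ∀ a b : V, mul a (mul b (mul a a)) = mul (mul a b) (mul a a)) :
    ∀ a b : V, mul (mul a a) * mul (mul b b) - mul (mul b b) * mul (mul a a) = 4 • (mul b * mul a * mul b * mul a - mul a * mul b * mul a * mul b + mul a * mul (mul a b) * mul b - mul b * mul (mul a b) * mul a) := by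
  intro a b
  have hL := jordan_linearized h2 mul comm jordan
  have hT : ∀ x, mul (mul a (mul b b)) x = mul (mul b b) (mul a x) +
      (2 : F) • mul (mul a b) (mul b x) - (2 : F) • mul b (mul a (mul b x)) := fun x => by
    have h := hL b x a
    rw [comm x (mul (mul b b) a), comm (mul b b) a, comm (mul b x) a, comm x a, comm b a,
      comm (mul b x) (mul a b)] at h
    linear_combination (norm := module) h
  ext x
  have h₁ := hL a (mul b b) x
  have h₂ := hL b a (mul a x)
  rw [comm b a] at h₂
  simp only [hT, map_add, map_sub, map_smul] at h₁
  simp only [LinearMap.sub_apply, LinearMap.add_apply, LinearMap.smul_apply, Module.End.mul_apply]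
  linear_combination (norm := module) (-1 : F) • h₁ + (2 : F) • h₂
end

section
/- In a Jordan algebra over a field of characteristic not 2, for all a, b: Q_a^2 Q_b + Q_a Q_b Q_a + Q_b Q_a^2 + 4 Q_{a,b}^2 Q_a + 4 Q_a Q_{a,b}^2 + 4 Q_{a,b} Q_a Q_{a,b} = Q_{a^2*b} + 4 Q_{a*(a*b)} + 4 Q_{a^2*b, a*(a*b)} + 4 Q_{a^3, b*(a*b)} + 2 Q_{a^3, b^2*a}, where a^3 := a*(a*a). -/
namespace JordanCube

variable {F V : Type*} [Field F] [AddCommGroup V] [Module F V]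

/-- The full linearization of the Jordan identity. -/
lemma linearized (h2 : (2 : F) ≠ 0) (mul : V →ₗ[F] V →ₗ[F] V)
    (comm : ∀ a b : V, mul a b = mul b a)
    (jordan : ∀ a b : V, mul a (mul b (mul a a)) = mul (mul a b) (mul a a))
    (a c d b : V) :
    mul a (mul b (mul c d)) + mul c (mul b (mul a d)) + mul d (mul b (mul a c)) =
      mul (mul a b) (mul c d) + mul (mul c b) (mul a d) + mul (mul d b) (mul a c) := by
  have hacd := jordan (a + c + d) b
  have hac := jordan (a + c) b
  have had := jordan (a + d) b
  have hcd := jordan (c + d) b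
  have ha := jordan a b
  have hc := jordan c b
  have hd := jordan d b
  simp only [map_add, LinearMap.add_apply, comm c a, comm d a, comm d c]
    at hacd hac had hcd ha hc hd
  apply sub_eq_zero.mp
  refine (smul_eq_zero_iff_right h2).mp ?_
  rw [two_smul]
  linear_combination (norm := abel) hacd - hac - had - hcd + ha + hc + hd

/-- The linearized Jordan identity, read as an identity between multiplication operators. -/
lemma operator_identity (h2 : (2 : F) ≠ 0) (mul : V →ₗ[F] V →ₗ[F] V)
    (comm : ∀ a b : V, mul a b = mul b a)
    (jordan : ∀ a b : V, mul a (mul b (mul a a)) = mul (mul a b) (mul a a))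
    (a b c : V) :
    mul (mul b (mul a c)) =
      mul (mul a b) * mul c + mul (mul c b) * mul a + mul (mul a c) * mul b
        - mul a * mul b * mul c - mul c * mul b * mul a := by
  ext d
  have h := linearized h2 mul comm jordan a c d b
  rw [comm d (mul b (mul a c)), comm (mul d b) (mul a c), comm d b] at h
  simp only [LinearMap.sub_apply, LinearMap.add_apply, Module.End.mul_apply]
  linear_combination (norm := abel) h

/-- The identity `Q_{a³} = Q_a³` in a Jordan algebra. -/
lemma quadratic_cube (h2 : (2 : F) ≠ 0) (mul : V →ₗ[F] V →ₗ[F] V)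
    (comm : ∀ a b : V, mul a b = mul b a)
    (jordan : ∀ a b : V, mul a (mul b (mul a a)) = mul (mul a b) (mul a a))
    (a : V) :
    2 • (mul (mul a (mul a a)) * mul (mul a (mul a a)))
        - mul (mul (mul a (mul a a)) (mul a (mul a a))) =
      (2 • (mul a * mul a) - mul (mul a a)) ^ 3 := by
  have op := operator_identity h2 mul comm jordan
  have hML : mul (mul a a) * mul a = mul a * mul (mul a a) := by
    ext b
    simp only [Module.End.mul_apply]
    rw [comm (mul a a) b, jordan a b, comm]
  have h3 := op a a a
  have h22 := op a (mul a a) a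
  have h13 := op a a (mul a a)
  have h23 := op a (mul a a) (mul a a)
  have h33 := op a (mul a (mul a a)) (mul a a)
  rw [comm (mul a a) a] at h13
  rw [h33, h13, h23, h22, h3]
  generalize mul (mul a a) = M at *
  generalize mul a = L at *
  have hML' (X : Module.End F V) : M * (L * X) = L * (M * X) := by
    rw [← mul_assoc, hML, mul_assoc]
  simp only [two_nsmul, pow_succ, pow_zero, one_mul, mul_add, add_mul, mul_sub, sub_mul,
    mul_assoc, hML, hML']
  abel

/-- The product of `V[t] / t³` induced by a product on `V`, with `(x, y, z)` standing for
`x + t y + t² z`. -/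
def truncatedMul (mul : V →ₗ[F] V →ₗ[F] V) :
    (V × V × V) →ₗ[F] (V × V × V) →ₗ[F] (V × V × V) :=
  LinearMap.mk₂ F
    (fun x y => (mul x.1 y.1, mul x.1 y.2.1 + mul x.2.1 y.1,
      mul x.1 y.2.2 + mul x.2.1 y.2.1 + mul x.2.2 y.1))
    (by intros; ext <;> simp <;> abel)
    (by intros; ext <;> simp)
    (by intros; ext <;> simp <;> abel)
    (by intros; ext <;> simp)

lemma truncatedMul_apply (mul : V →ₗ[F] V →ₗ[F] V) (x y : V × V × V) :
    truncatedMul mul x y = (mul x.1 y.1, mul x.1 y.2.1 + mul x.2.1 y.1,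
      mul x.1 y.2.2 + mul x.2.1 y.2.1 + mul x.2.2 y.1) := rfl

lemma truncatedMul_comm (mul : V →ₗ[F] V →ₗ[F] V)
    (comm : ∀ a b : V, mul a b = mul b a) (x y : V × V × V) :
    truncatedMul mul x y = truncatedMul mul y x := by
  simp only [truncatedMul_apply, comm y.1, comm y.2.1, comm y.2.2, Prod.mk.injEq, true_and]
  constructor <;> abel

lemma truncatedMul_jordan (h2 : (2 : F) ≠ 0) (mul : V →ₗ[F] V →ₗ[F] V)
    (comm : ∀ a b : V, mul a b = mul b a)
    (jordan : ∀ a b : V, mul a (mul b (mul a a)) = mul (mul a b) (mul a a))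
    (x y : V × V × V) :
    truncatedMul mul x (truncatedMul mul y (truncatedMul mul x x)) =
      truncatedMul mul (truncatedMul mul x y) (truncatedMul mul x x) := by
  obtain ⟨x₀, x₁, x₂⟩ := x
  obtain ⟨y₀, y₁, y₂⟩ := y
  have lin := linearized h2 mul comm jordan
  have h₁ := jordan x₀ y₁
  have h₂ := jordan x₀ y₂
  have h₀₁ := lin x₀ x₀ x₁ y₀
  have h₀₁' := lin x₀ x₀ x₁ y₁
  have h₀₂ := lin x₀ x₀ x₂ y₀
  have h₁₁ := lin x₀ x₁ x₁ y₀
  simp only [truncatedMul_apply, map_add, LinearMap.add_apply, Prod.mk.injEq, comm x₁ x₀,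
    comm x₂ x₀] at *
  refine ⟨jordan x₀ y₀, ?_, ?_⟩
  · linear_combination (norm := abel) h₁ + h₀₁
  · linear_combination (norm := abel) h₂ + h₀₁' + h₀₂ + h₁₁

end JordanCube

theorem stmt13 {F V : Type*} [Field F] (h2 : (2 : F) ≠ 0)
    [AddCommGroup V] [Module F V]
    (mul : V →ₗ[F] V →ₗ[F] V)
    (comm : ∀ a b : V, mul a b = mul b a)
    (jordan : ∀ a b : V, mul a (mul b (mul a a)) = mul (mul a b) (mul a a))
    (Q : V → Module.End F V)
    (hQ : ∀ a : V, Q a = 2 • (mul a * mul a) - mul (mul a a))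
    (Q2 : V → V → Module.End F V)
    (hQ2 : ∀ a b : V, Q2 a b = mul a * mul b + mul b * mul a - mul (mul a b)) :
    ∀ a b : V, (Q a) ^ 2 * Q b + Q a * Q b * Q a + Q b * (Q a) ^ 2 + 4 • ((Q2 a b) ^ 2 * Q a) + 4 • (Q a * (Q2 a b) ^ 2) + 4 • (Q2 a b * Q a * Q2 a b) = Q (mul (mul a a) b) + 4 • Q (mul a (mul a b)) + 4 • Q2 (mul (mul a a) b) (mul a (mul a b)) + 4 • Q2 (mul a (mul a a)) (mul b (mul a b)) + 2 • Q2 (mul a (mul a a)) (mul (mul b b) a) := by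
  intro a b
  have cube := JordanCube.quadratic_cube h2 _ (JordanCube.truncatedMul_comm mul comm)
    (JordanCube.truncatedMul_jordan h2 mul comm jordan) (a, b, 0)
  ext v
  have h := congrArg (fun p => p.2.2) (LinearMap.congr_fun cube (v, 0, 0))
  simp only [hQ, hQ2, pow_succ, pow_zero, one_mul, two_nsmul, LinearMap.sub_apply,
    LinearMap.add_apply, LinearMap.smul_apply, Module.End.mul_apply,
    JordanCube.truncatedMul_apply, map_add, map_sub, map_zero, LinearMap.zero_apply, add_zero,
    zero_add, Prod.snd_add, Prod.snd_sub, comm b a,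
    comm b (mul a a), comm (mul b b) a, comm (mul a (mul a b)) (mul (mul a a) b),
    comm (mul b (mul a b)) (mul a (mul a a)), comm (mul a (mul b b)) (mul a (mul a a))] at h ⊢
  linear_combination (norm := abel) -h
end

section
/- In a Jordan algebra over a field of characteristic not 2, the fundamental identity holds: Q_{Q_a b} = Q_a Q_b Q_a for all a, b. -/
namespace LinearJordan

section

variable {F V : Type*} [Field F] [AddCommGroup V] [Module F V]

/-- Half of the Jordan triple product: `(x y) z + x (y z) - y (x z)`. -/
def triple (mul : V →ₗ[F] V →ₗ[F] V) (x y z : V) : V :=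
  mul (mul x y) z + mul x (mul y z) - mul y (mul x z)

variable {mul : V →ₗ[F] V →ₗ[F] V}

theorem triple_swap (comm : ∀ a b : V, mul a b = mul b a) (x y z : V) :
    triple mul x y z = triple mul z y x := by
  simp only [triple]
  rw [comm (mul x y) z, comm x y, comm y z, comm x (mul z y), comm x z]
  abel

theorem triple_sub_middle (x y y' z : V) :
    triple mul x (y - y') z = triple mul x y z - triple mul x y' z := by
  simp only [triple, map_sub, LinearMap.sub_apply]
  abel

/-- Partial linearization of the Jordan identity. -/
theorem jordan_linearized (h2 : (2 : F) ≠ 0) (comm : ∀ a b : V, mul a b = mul b a)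
    (jordan : ∀ a b : V, mul a (mul b (mul a a)) = mul (mul a b) (mul a a)) (a b z : V) :
    (2 : F) • (mul a (mul (mul a b) z) - mul (mul a b) (mul a z))
      + (mul b (mul (mul a a) z) - mul (mul a a) (mul b z)) = 0 := by
  have h : ∀ u, mul u (mul (mul u u) z) - mul (mul u u) (mul u z) = 0 := fun u => by
    rw [comm (mul u u) z, jordan, comm (mul u u), sub_self]
  have hp := h (a + b)
  have hm := h (a - b)
  have hb := h b
  simp only [map_add, map_sub, LinearMap.add_apply, LinearMap.sub_apply, comm b a] at hp hm
  refine smul_right_injective V h2 ?_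
  dsimp only
  linear_combination (norm := module) hp - hm - (2 : F) • hb

/-- Full linearization of the Jordan identity. -/
theorem jordan_multilinear (h2 : (2 : F) ≠ 0) (comm : ∀ a b : V, mul a b = mul b a)
    (jordan : ∀ a b : V, mul a (mul b (mul a a)) = mul (mul a b) (mul a a)) (a b c z : V) :
    (mul a (mul (mul b c) z) - mul (mul b c) (mul a z))
      + (mul b (mul (mul c a) z) - mul (mul c a) (mul b z))
      + (mul c (mul (mul a b) z) - mul (mul a b) (mul c z)) = 0 := by
  have h := jordan_linearized h2 comm jordan (a + c) b z
  have ha := jordan_linearized h2 comm jordan a b z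
  have hc := jordan_linearized h2 comm jordan c b z
  simp only [map_add, LinearMap.add_apply, comm a c, comm c b] at h ha hc
  refine smul_right_injective V h2 ?_
  dsimp only
  rw [comm b c] at *
  linear_combination (norm := module) h - ha - hc

theorem mul_mul_mul_add (h2 : (2 : F) ≠ 0) (comm : ∀ a b : V, mul a b = mul b a)
    (jordan : ∀ a b : V, mul a (mul b (mul a a)) = mul (mul a b) (mul a a)) (a b c z : V) :
    mul a (mul b (mul c z)) + mul c (mul b (mul a z)) + mul (mul (mul a c) b) z
      = mul (mul a b) (mul c z) + mul (mul b c) (mul a z) + mul (mul a c) (mul b z) := by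
  have h := jordan_multilinear h2 comm jordan a c z b
  rw [comm (mul c z) b, comm (mul z a) b, comm z a, comm z (mul (mul a c) b),
    comm (mul c z) (mul a b), comm c b, comm (mul a z) (mul b c), comm z b] at h
  linear_combination (norm := module) h

/-- Commutators of multiplication operators are derivations. -/
theorem commutator_mul (h2 : (2 : F) ≠ 0) (comm : ∀ a b : V, mul a b = mul b a)
    (jordan : ∀ a b : V, mul a (mul b (mul a a)) = mul (mul a b) (mul a a)) (a b c z : V) :
    mul a (mul b (mul c z)) - mul b (mul a (mul c z))
      = mul (mul a (mul b c)) z - mul (mul b (mul a c)) z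
        + mul c (mul a (mul b z)) - mul c (mul b (mul a z)) := by
  have h := mul_mul_mul_add h2 comm jordan a b c z
  have h' := mul_mul_mul_add h2 comm jordan b a c z
  rw [comm (mul a c) b] at h
  rw [comm (mul b c) a, comm b a] at h'
  linear_combination (norm := module) h - h'

/-- The five-linear Jordan triple identity when the first pair acts through left multiplication. -/
theorem mul_triple (h2 : (2 : F) ≠ 0) (comm : ∀ a b : V, mul a b = mul b a)
    (jordan : ∀ a b : V, mul a (mul b (mul a a)) = mul (mul a b) (mul a a)) (w u v z : V) :
    mul w (triple mul u v z) - triple mul u v (mul w z)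
      = triple mul (mul w u) v z - triple mul u (mul w v) z := by
  have h := jordan_multilinear h2 comm jordan w u v z
  have h' := commutator_mul h2 comm jordan u v w z
  simp only [triple, map_add, map_sub]
  rw [comm (mul w u) v, comm w u, comm w v] at *
  rw [comm v w] at *
  linear_combination (norm := module) h - h'

/-- Commutators of multiplication operators are derivations of the triple product. -/
theorem commutator_triple (h2 : (2 : F) ≠ 0) (comm : ∀ a b : V, mul a b = mul b a)
    (jordan : ∀ a b : V, mul a (mul b (mul a a)) = mul (mul a b) (mul a a)) (x y u v z : V) :
    mul x (mul y (triple mul u v z)) - mul y (mul x (triple mul u v z))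
      = triple mul (mul x (mul y u) - mul y (mul x u)) v z
        + triple mul u (mul x (mul y v) - mul y (mul x v)) z
        + triple mul u v (mul x (mul y z) - mul y (mul x z)) := by
  have h := commutator_mul h2 comm jordan x y
  have h₁ := h (mul u v) z
  have h₂ := h u (mul v z)
  have h₃ := h v (mul u z)
  have h₄ := congrArg (fun t => mul t z) (h u v)
  have h₅ := congrArg (mul u) (h v z)
  have h₆ := congrArg (mul v) (h u z)
  simp only [triple, map_add, map_sub, LinearMap.add_apply, LinearMap.sub_apply] at *
  linear_combination (norm := module) h₁ + h₂ - h₃ + h₄ + h₅ - h₆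

/-- The five-linear Jordan triple identity. -/
theorem triple_triple (h2 : (2 : F) ≠ 0) (comm : ∀ a b : V, mul a b = mul b a)
    (jordan : ∀ a b : V, mul a (mul b (mul a a)) = mul (mul a b) (mul a a)) (x y u v z : V) :
    triple mul x y (triple mul u v z) - triple mul u v (triple mul x y z)
      = triple mul (triple mul x y u) v z - triple mul u (triple mul y x v) z := by
  have h := mul_triple h2 comm jordan (mul x y) u v z
  have h' := commutator_triple h2 comm jordan x y u v z
  simp only [triple, map_add, map_sub, LinearMap.add_apply, LinearMap.sub_apply,
    comm y x] at *
  linear_combination (norm := module) h + h'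

theorem triple_quadratic (h2 : (2 : F) ≠ 0) (comm : ∀ a b : V, mul a b = mul b a)
    (jordan : ∀ a b : V, mul a (mul b (mul a a)) = mul (mul a b) (mul a a)) (x y z : V) :
    triple mul x y (triple mul x z x) = triple mul x (triple mul y x z) x := by
  have hQ : ∀ w, triple mul x w x = (2 : F) • mul x (mul x w) - mul (mul x x) w := fun w => by
    simp only [triple]
    rw [comm (mul x w) x, comm w x, comm w (mul x x)]
    module
  have hS : ∀ w, mul x (mul (mul x x) w) = mul (mul x x) (mul x w) := fun w => by
    rw [comm (mul x x) w, jordan, comm (mul x x)]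
  have hJ := jordan_linearized h2 comm jordan x
  have h₁ := hJ (mul x y) z
  have h₂ := hJ y (mul x z)
  have h₃ := congrArg (mul x) (hJ y z)
  have hL : ∀ w, mul (mul x (mul x y)) w = mul (mul x x) (mul y w)
      + (2 : F) • mul (mul x y) (mul x w) - mul x (mul x (mul y w)) - mul y (mul x (mul x w)) :=
    fun w => by
      have h := mul_mul_mul_add h2 comm jordan x x y w
      rw [comm (mul x y) x] at h
      linear_combination (norm := module) h
  rw [hQ, hQ]
  simp only [triple, hL, map_add, map_sub, map_smul, map_zero, comm y x, hS] at *
  linear_combination (norm := module) h₂ - h₁ - h₃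

theorem fundamental_triple (h2 : (2 : F) ≠ 0) (comm : ∀ a b : V, mul a b = mul b a)
    (jordan : ∀ a b : V, mul a (mul b (mul a a)) = mul (mul a b) (mul a a)) (x y c : V) :
    triple mul (triple mul x y x) c (triple mul x y x)
      = triple mul x (triple mul y (triple mul x c x) y) x := by
  have h5 := triple_triple h2 comm jordan
  have hq := triple_quadratic h2 comm jordan
  have hs := triple_swap comm
  have hx : ∀ b e, triple mul x e (triple mul x b x) = triple mul x b (triple mul x e x) := by
    intro b e
    have h := h5 x b x e x
    rw [hs (triple mul x b x) e x, ← hq] at h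
    refine (smul_right_injective V h2) ?_
    dsimp only
    linear_combination (norm := module) -h
  have key := h5 x y x c (triple mul x y x)
  rw [hx y c, hx y (triple mul y x c), hq x y c, hq x y y, hq x y (triple mul y x c),
    hx (triple mul y x y) c, hq x _ c] at key
  have h := h5 c x y x y
  rw [hs c x y, hs (triple mul y x c) x y, hs c x (triple mul y x y)] at h
  have h' := congrArg (fun t => triple mul x t x) h
  simp only [triple_sub_middle] at h'
  linear_combination (norm := module) -h' - key

end

end LinearJordan

theorem stmt15 {F V : Type*} [Field F] (h2 : (2 : F) ≠ 0)
    [AddCommGroup V] [Module F V]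
    (mul : V →ₗ[F] V →ₗ[F] V)
    (comm : ∀ a b : V, mul a b = mul b a)
    (jordan : ∀ a b : V, mul a (mul b (mul a a)) = mul (mul a b) (mul a a))
    (Q : V → Module.End F V)
    (hQ : ∀ a : V, Q a = 2 • (mul a * mul a) - mul (mul a a)) :
    ∀ a b : V, Q (Q a b) = Q a * Q b * Q a := by
  have hT : ∀ a b, Q a b = LinearJordan.triple mul a b a := fun a b => by
    rw [hQ, LinearJordan.triple, comm (mul a b) a, comm b a, comm b (mul a a), two_smul]
    rfl
  intro a b
  ext c
  simp only [Module.End.mul_apply, hT]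
  exact LinearJordan.fundamental_triple h2 comm jordan a b c
end
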